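/- arXiv:1902.03483 — 2 statements merged into one kernel-verified Lean document; each statement's English description precedes it below -/
import Mathlib

section
/- Let m be a natural number and β = 1 − ρ. For all integers a, b, k, j, the congruence a + bρ ≡ (a + 3^m·k) + (b + 3^m·j)ρ (mod β^{2m+1}) holds if and only if k + j ≡ 0 (mod 3). -/
open Polynomial

/-- The Eisenstein integers `ℤ[ρ]`, realized as `ℤ[X]/(X² + X + 1)`. -/
abbrev Eisenstein : Type := AdjoinRoot (X ^ 2 + X + 1 : ℤ[X])

/-- The primitive cube root of unity `ρ` in `ℤ[ρ]`. -/
noncomputable def ρ : Eisenstein := AdjoinRoot.root (X ^ 2 + X + 1 : ℤ[X])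

/-- The "even" Eisenstein prime `β = 1 - ρ`. -/
noncomputable def β : Eisenstein := 1 - ρ

theorem ρ_sq_add_ρ_add_one : ρ ^ 2 + ρ + 1 = 0 := by
  have h := AdjoinRoot.eval₂_root (X ^ 2 + X + 1 : ℤ[X])
  rwa [eval₂_add, eval₂_add, eval₂_pow, eval₂_X, eval₂_one] at h

theorem β_dvd_three : β ∣ 3 :=
  ⟨2 + ρ, by rw [β]; linear_combination ρ_sq_add_ρ_add_one⟩

theorem β_pow_two_mul (m : ℕ) : β ^ (2 * m) = 3 ^ m * (-ρ) ^ m := by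
  rw [pow_mul, ← mul_pow]
  congr 1
  rw [β]
  linear_combination ρ_sq_add_ρ_add_one

theorem isUnit_neg_ρ : IsUnit (-ρ) :=
  IsUnit.of_mul_eq_one (ρ + 1) (by linear_combination -ρ_sq_add_ρ_add_one)

theorem Eisenstein.three_pow_mul_left_cancel (m : ℕ) {x y : Eisenstein}
    (h : 3 ^ m * x = 3 ^ m * y) : x = y := by
  have hmonic : (X ^ 2 + X + 1 : ℤ[X]).Monic := by monicity!
  have : Module.Free ℤ Eisenstein := hmonic.free_adjoinRoot
  refine smul_right_injective Eisenstein (r := (3 : ℤ) ^ m) (by positivity) ?_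
  simpa [zsmul_eq_mul] using h

/-- Reduction modulo `β`, sending `ρ` to `1`. -/
noncomputable def Eisenstein.toZModThree : Eisenstein →+* ZMod 3 :=
  AdjoinRoot.lift (Int.castRingHom (ZMod 3)) 1 (by simp; decide)

theorem Eisenstein.toZModThree_ρ : Eisenstein.toZModThree ρ = 1 :=
  AdjoinRoot.lift_root _

theorem β_dvd_intCast_add_mul_ρ_iff (k j : ℤ) :
    β ∣ (k : Eisenstein) + j * ρ ↔ (3 : ℤ) ∣ k + j := by
  constructor
  · rintro ⟨c, hc⟩
    have h := congrArg Eisenstein.toZModThree hc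
    simp only [map_add, map_mul, map_intCast, β, map_sub, map_one, Eisenstein.toZModThree_ρ,
      mul_one, sub_self, zero_mul] at h
    exact (ZMod.intCast_zmod_eq_zero_iff_dvd (k + j) 3).mp (by exact_mod_cast h)
  · rintro ⟨c, hc⟩
    have hc' : (k : Eisenstein) + j = 3 * c := by exact_mod_cast congrArg (Int.cast) hc
    have h : (k : Eisenstein) + j * ρ = 3 * c - β * j := by
      rw [β]; linear_combination hc'
    rw [h]
    exact dvd_sub (β_dvd_three.mul_right _) (dvd_mul_right _ _)

theorem stmt11 (m : ℕ) (a b k j : ℤ) :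
    (β ^ (2 * m + 1) ∣
        (((a + 3 ^ m * k : ℤ) : Eisenstein) + ((b + 3 ^ m * j : ℤ) : Eisenstein) * ρ)
          - ((a : Eisenstein) + b * ρ)) ↔ k + j ≡ 0 [ZMOD 3] := by
  have hdiff : (((a + 3 ^ m * k : ℤ) : Eisenstein) + ((b + 3 ^ m * j : ℤ) : Eisenstein) * ρ)
      - ((a : Eisenstein) + b * ρ) = 3 ^ m * (k + j * ρ) := by
    push_cast
    ring
  rw [hdiff, Int.modEq_zero_iff_dvd, ← β_dvd_intCast_add_mul_ρ_iff, pow_succ β, β_pow_two_mul,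
    mul_assoc]
  have hunit : (-ρ) ^ m * β ∣ (k : Eisenstein) + j * ρ ↔ β ∣ (k : Eisenstein) + j * ρ :=
    (isUnit_neg_ρ.pow m).mul_left_dvd
  rw [← hunit]
  refine ⟨fun ⟨c, hc⟩ => ⟨c, ?_⟩, mul_dvd_mul_left _⟩
  exact Eisenstein.three_pow_mul_left_cancel m (by rw [hc, mul_assoc])
end

section
/- Let q be a rational prime with q ≡ 1 (mod 3), let ψ be a prime element of ℤ[ρ] with N(ψ) = q and ψψ̄ = q, let n ≥ 1, and write ψ^n = x + yρ with x, y ∈ ℤ (so that q^n = x² + y² − xy). Then for all integers a, b, c, the congruence a + bρ ≡ c (mod ψ^n) in ℤ[ρ] holds if and only if −ay + bx ≡ −cy (mod q^n) in ℤ. -/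
open Polynomial

lemma rho_sq : ρ ^ 2 = -1 - ρ := by
  have h := AdjoinRoot.eval₂_root (X ^ 2 + X + 1 : ℤ[X])
  simp only [eval₂_add, eval₂_pow, eval₂_X, eval₂_one] at h
  change ρ ^ 2 + ρ + 1 = 0 at h
  linear_combination h

lemma Eisenstein.exists_eq_add_mul_rho (z : Eisenstein) :
    ∃ u v : ℤ, z = (u : Eisenstein) + v * ρ := by
  induction z using AdjoinRoot.induction_on with
  | ih p =>
    induction p using Polynomial.induction_on' with
    | add p r hp hr =>
      obtain ⟨u, v, h⟩ := hp
      obtain ⟨s, t, k⟩ := hr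
      refine ⟨u + s, v + t, ?_⟩
      rw [map_add, h, k]
      push_cast
      ring
    | monomial n c =>
      induction n with
      | zero => exact ⟨c, 0, by simp⟩
      | succ n ih =>
        obtain ⟨u, v, h⟩ := ih
        refine ⟨-v, u - v, ?_⟩
        rw [← monomial_mul_X, map_mul, h, AdjoinRoot.mk_X]
        change _ * ρ = _
        push_cast
        linear_combination (v : Eisenstein) * rho_sq

lemma Eisenstein.eq_zero_of_add_mul_rho_eq_zero {u v : ℤ}
    (h : (u : Eisenstein) + v * ρ = 0) : u = 0 ∧ v = 0 := by
  have hmk : AdjoinRoot.mk (X ^ 2 + X + 1 : ℤ[X]) (C v * X + C u) = 0 := by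
    rw [map_add, map_mul, AdjoinRoot.mk_X, AdjoinRoot.mk_C, AdjoinRoot.mk_C, eq_intCast,
      eq_intCast]
    exact (add_comm _ _).trans h
  have hdeg : (C v * X + C u).degree < (X ^ 2 + X + 1 : ℤ[X]).degree := by
    have h2 : (X ^ 2 + X + 1 : ℤ[X]).degree = 2 := by compute_degree!
    rw [h2]
    exact degree_linear_le.trans_lt (by norm_num)
  have h0 := eq_zero_of_dvd_of_degree_lt (AdjoinRoot.mk_eq_zero.mp hmk) hdeg
  exact ⟨by simpa using congrArg (coeff · 0) h0, by simpa [coeff_C, -eq_intCast, -map_intCast] using congrArg (coeff · 1) h0⟩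

lemma Eisenstein.add_mul_rho_inj {u v s t : ℤ} :
    (u : Eisenstein) + v * ρ = (s : Eisenstein) + t * ρ ↔ u = s ∧ v = t := by
  refine ⟨fun h => ?_, by rintro ⟨rfl, rfl⟩; rfl⟩
  obtain ⟨h1, h2⟩ := eq_zero_of_add_mul_rho_eq_zero (u := u - s) (v := v - t)
    (by push_cast; linear_combination h)
  exact ⟨sub_eq_zero.mp h1, sub_eq_zero.mp h2⟩

/-- Multiplication in the basis `1, ρ`. -/
lemma Eisenstein.add_mul_rho_mul (x y u v : ℤ) :
    ((x : Eisenstein) + y * ρ) * (u + v * ρ) =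
      ((x * u - y * v : ℤ) : Eisenstein) + ((x * v + y * u - y * v : ℤ) : Eisenstein) * ρ := by
  push_cast
  linear_combination (y * v : Eisenstein) * rho_sq

lemma Eisenstein.add_mul_rho_dvd_iff {x y d b : ℤ} :
    (x : Eisenstein) + y * ρ ∣ (d : Eisenstein) + b * ρ ↔
      ∃ u v : ℤ, d = x * u - y * v ∧ b = x * v + y * u - y * v := by
  constructor
  · rintro ⟨z, hz⟩
    obtain ⟨u, v, rfl⟩ := exists_eq_add_mul_rho z
    rw [add_mul_rho_mul, add_mul_rho_inj] at hz
    exact ⟨u, v, hz⟩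
  · rintro ⟨u, v, rfl, rfl⟩
    exact ⟨u + v * ρ, (add_mul_rho_mul x y u v).symm⟩

/-- Divisibility by an Eisenstein integer with coprime coordinates is a single congruence
modulo its norm. -/
lemma Eisenstein.add_mul_rho_dvd_iff_of_isCoprime {x y d b : ℤ} (hxy : IsCoprime x y) :
    (x : Eisenstein) + y * ρ ∣ (d : Eisenstein) + b * ρ ↔
      x ^ 2 - x * y + y ^ 2 ∣ b * x - d * y := by
  rw [add_mul_rho_dvd_iff]
  constructor
  · rintro ⟨u, v, rfl, rfl⟩
    exact ⟨v, by ring⟩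
  · rintro ⟨v, hv⟩
    obtain ⟨r, s, hrs⟩ := hxy
    refine ⟨r * (d + y * v) + s * (b - x * v + y * v), v, ?_, ?_⟩
    · linear_combination (-(d + y * v)) * hrs - s * hv
    · linear_combination (-(b - x * v + y * v)) * hrs + r * hv

/-- Coordinates of powers of `A + Bρ`: their norm, and their image under the residue map modulo
the conjugate prime (scaled by `B`). -/
lemma Eisenstein.exists_pow_eq (A B : ℤ) (n : ℕ) :
    ∃ x y : ℤ, ((A : Eisenstein) + B * ρ) ^ n = (x : Eisenstein) + y * ρ ∧
      x ^ 2 - x * y + y ^ 2 = (A ^ 2 - A * B + B ^ 2) ^ n ∧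
      A ^ 2 - A * B + B ^ 2 ∣ B * x + (A - B) * y - B * (2 * A - B) ^ n := by
  induction n with
  | zero => exact ⟨1, 0, by simp⟩
  | succ n ih =>
    obtain ⟨x, y, h, hnorm, k, hk⟩ := ih
    refine ⟨x * A - y * B, x * B + y * A - y * B, ?_, ?_, (2 * A - B) * k - y, ?_⟩
    · rw [pow_succ, h, add_mul_rho_mul]
    · rw [pow_succ _ n, ← hnorm]
      ring
    · linear_combination (2 * A - B) * hk

lemma not_dvd_of_norm_eq_prime {q A B : ℤ} (hq : Prime q)
    (hN : A ^ 2 - A * B + B ^ 2 = q) : ¬ q ∣ B := by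
  intro hB
  have hA : q ∣ A := by
    refine hq.dvd_of_dvd_pow (n := 2) ?_
    rw [show A ^ 2 = q + B * (A - B) by linear_combination hN]
    exact dvd_add dvd_rfl (hB.mul_right _)
  obtain ⟨s, rfl⟩ := hA
  obtain ⟨t, rfl⟩ := hB
  refine hq.not_isUnit (isUnit_of_dvd_one ⟨s ^ 2 - s * t + t ^ 2, ?_⟩)
  exact mul_left_cancel₀ hq.ne_zero (by linear_combination -hN)

lemma not_dvd_two_mul_sub_of_norm_eq_prime {q A B : ℤ} (hq : Prime q) (hq3 : ¬ q ∣ 3)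
    (hN : A ^ 2 - A * B + B ^ 2 = q) : ¬ q ∣ 2 * A - B := by
  intro h
  have h3 : q ∣ 3 * B ^ 2 := by
    rw [show 3 * B ^ 2 = q * 4 - (2 * A - B) * (2 * A - B) by linear_combination 4 * hN]
    exact dvd_sub (dvd_mul_right _ _) (h.mul_right _)
  exact (hq.dvd_or_dvd h3).elim hq3
    fun h => not_dvd_of_norm_eq_prime hq hN (hq.dvd_of_dvd_pow h)

lemma isCoprime_of_norm_eq_prime_pow {q x y : ℤ} {n : ℕ} (hq : Prime q)
    (hN : x ^ 2 - x * y + y ^ 2 = q ^ n) (h : ¬ (q ∣ x ∧ q ∣ y)) : IsCoprime x y := by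
  by_cases hx : q ∣ x
  · have hy : IsCoprime y (q ^ n) :=
      ((hq.irreducible.coprime_iff_not_dvd.mpr fun hy => h ⟨hx, hy⟩).symm).pow_right
    rw [← hN, show x ^ 2 - x * y + y ^ 2 = x ^ 2 + y * (y - x) by ring,
      IsCoprime.add_mul_left_right_iff] at hy
    exact ((IsCoprime.pow_right_iff two_pos).mp hy).symm
  · have hx : IsCoprime x (q ^ n) := (hq.irreducible.coprime_iff_not_dvd.mpr hx).symm.pow_right
    rw [← hN, show x ^ 2 - x * y + y ^ 2 = y ^ 2 + x * (x - y) by ring,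
      IsCoprime.add_mul_left_right_iff] at hx
    exact (IsCoprime.pow_right_iff two_pos).mp hx

theorem stmt12 (q : ℕ) (hq : q.Prime) (hq1 : q % 3 = 1) (A B : ℤ)
    (hψ : Prime ((A : Eisenstein) + B * ρ))
    (hN : A ^ 2 - A * B + B ^ 2 = (q : ℤ)) (n : ℕ) (hn : 1 ≤ n) (x y : ℤ)
    (hxy : ((A : Eisenstein) + B * ρ) ^ n = (x : Eisenstein) + y * ρ) :
    ∀ a b c : ℤ,
      (((A : Eisenstein) + B * ρ) ^ n ∣ ((a : Eisenstein) + b * ρ) - (c : Eisenstein)) ↔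
        -(a * y) + b * x ≡ -(c * y) [ZMOD (q : ℤ) ^ n] := by
  intro a b c
  have hqp : Prime (q : ℤ) := Nat.prime_iff_prime_int.mp hq
  have hq3 : ¬ (q : ℤ) ∣ 3 := by
    intro h
    have h3 : q ∣ 3 := by exact_mod_cast h
    rw [(Nat.prime_dvd_prime_iff_eq hq Nat.prime_three).mp h3] at hq1
    norm_num at hq1
  obtain ⟨x', y', hpow, hnorm, hres⟩ := Eisenstein.exists_pow_eq A B n
  obtain ⟨rfl, rfl⟩ := Eisenstein.add_mul_rho_inj.mp (hxy.symm.trans hpow)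
  rw [hN] at hnorm hres
  have hcop : IsCoprime x y := by
    refine isCoprime_of_norm_eq_prime_pow hqp hnorm fun ⟨hx, hy⟩ => ?_
    have h := (dvd_sub_right (dvd_add (hx.mul_left B) (hy.mul_left (A - B)))).mp hres
    exact (hqp.dvd_or_dvd h).elim (not_dvd_of_norm_eq_prime hqp hN)
      fun h => not_dvd_two_mul_sub_of_norm_eq_prime hqp hq3 hN (hqp.dvd_of_dvd_pow h)
  rw [hxy, show (a : Eisenstein) + b * ρ - c = ((a - c : ℤ) : Eisenstein) + b * ρ by
      push_cast; ring, Eisenstein.add_mul_rho_dvd_iff_of_isCoprime hcop, hnorm,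
    Int.modEq_comm, Int.modEq_iff_dvd]
  ring_nf
end
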